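/- Let R be a field and let ρ, ρ' : G → GL_d(R) be two semisimple finite-dimensional representations of a group G. If the characteristic polynomials of ρ(g) and ρ'(g) agree for all g ∈ G, then ρ and ρ' are isomorphic (Brauer–Nesbitt). -/

import Mathlib

universe u v

section BN
open Polynomial

theorem bn_key1 {A G : Type*} [CommRing A] [Monoid G] (t : A) (N : ℕ) (ht : t ^ N = 0)
    (D D' : MonoidAlgebra A G →* A)
    (h : ∀ g c, D (1 - MonoidAlgebra.single g c) = D' (1 - MonoidAlgebra.single g c))
    (x : MonoidAlgebra A G) : D (1 - t • x) = D' (1 - t • x) := by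
  have claim : ∀ k e : ℕ, N ≤ e + 1 + k → ∀ x : MonoidAlgebra A G,
      D (1 - t ^ (e + 1) • x) = D' (1 - t ^ (e + 1) • x) := by
    intro k
    induction k with
    | zero =>
      intro e he x
      have : t ^ (e + 1) = 0 := pow_eq_zero_of_le (by omega) ht
      simp [this]
    | succ k ih =>
      intro e he x
      have inner : ∀ y z : MonoidAlgebra A G,
          D (1 - (t ^ (e + 1) • y + t ^ (e + 2) • z)) =
            D' (1 - (t ^ (e + 1) • y + t ^ (e + 2) • z)) := by
        intro y
        induction y using MonoidAlgebra.induction with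
        | zero =>
          intro z
          simpa using ih (e + 1) (by omega) z
        | single_add g c y _ _ hy =>
          intro z
          set s := MonoidAlgebra.single g c with hs
          have hnil : IsNilpotent (t ^ (e + 1) • s) := by
            refine ⟨N, ?_⟩
            rw [_root_.smul_pow, ← pow_mul, mul_comm, pow_mul, ht, zero_pow (by omega), zero_smul]
          obtain ⟨v, hv⟩ := hnil.isUnit_one_sub
          obtain ⟨u, hu1⟩ : ∃ u, (1 - t ^ (e + 1) • s) * u = 1 := ⟨↑v⁻¹, by rw [← hv]; simp⟩
          have hu : u = 1 + t ^ (e + 1) • s * u := by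
            rw [sub_mul, one_mul] at hu1
            rw [← hu1]; abel
          set B := t ^ (e + 1) • y + t ^ (e + 2) • z with hB
          have h1 : u * B = t ^ (e + 1) • y +
              t ^ (e + 2) • (z + t ^ e • (s * u * (y + t • z))) := by
            conv_lhs => rw [hu]
            rw [add_mul, one_mul, hB]
            simp only [smul_mul_assoc, mul_smul_comm, mul_add, smul_add, smul_smul, ← pow_add]
            module
          have h2 : 1 - (t ^ (e + 1) • (s + y) + t ^ (e + 2) • z) =
              (1 - t ^ (e + 1) • s) * (1 - u * B) := by
            rw [mul_sub, ← mul_assoc, hu1, hB]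
            simp only [smul_add, mul_one, one_mul]
            abel
          have h3 : t ^ (e + 1) • s = MonoidAlgebra.single g (t ^ (e + 1) * c) := by
            simp [hs]
          rw [h2, map_mul, map_mul, h1, hy, h3, h]
      simpa using inner x 0
  simpa using claim N 0 (by omega) x

theorem bn_aux {R A G n : Type*} [Field R] [CommRing A] [Monoid G] [Fintype n] [DecidableEq n]
    (q : R[X] →+* A) (φ : G →* Matrix n n R) :
    ∃ D : MonoidAlgebra A G →* A,
      (∀ g c, D (1 - MonoidAlgebra.single g c) = (φ g).charpolyRev.eval₂ (q.comp C) c) ∧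
      ∀ x : MonoidAlgebra R G, D (1 - q X • MonoidAlgebra.mapRingHom G (q.comp C) x) =
        q (MonoidAlgebra.lift R _ G φ x).charpolyRev := by
  set f := q.comp C with hf
  let F : G →* Matrix n n A := (f.mapMatrix : Matrix n n R →+* Matrix n n A).toMonoidHom.comp φ
  have hF : ∀ g, F g = (φ g).map f := fun g => rfl
  refine ⟨Matrix.detMonoidHom.comp ((MonoidAlgebra.lift A _ G F : MonoidAlgebra A G →ₐ[A] Matrix n n A) :
    MonoidAlgebra A G →* Matrix n n A), ?_, ?_⟩
  · intro g c
    have : (φ g).charpolyRev.eval₂ f c = Polynomial.eval₂RingHom f c (φ g).charpolyRev := rfl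
    rw [this, Matrix.charpolyRev, RingHom.map_det]
    simp [hF]
    congr 1
    ext i j
    simp [Matrix.one_apply, apply_ite]
    exact mul_comm _ _
  · intro x
    have hx : MonoidAlgebra.lift A _ G F (MonoidAlgebra.mapRingHom G f x) =
        (MonoidAlgebra.lift R _ G φ x).map f := by
      induction x using MonoidAlgebra.induction_linear with
      | zero => simp
      | add x y hx hy => simp [hx, hy, Matrix.map_add]
      | single g r => 
        simp [hF]
        ext i j
        simp
    rw [Matrix.charpolyRev, RingHom.map_det]
    simp [hx]
    congr 1
    ext i j
    simp [Matrix.one_apply, apply_ite, hf]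
    exact mul_comm _ _

theorem bn_key2 {R G n m : Type*} [Field R] [Monoid G] [Fintype n] [DecidableEq n]
    [Fintype m] [DecidableEq m] (φ : G →* Matrix n n R) (ψ : G →* Matrix m m R)
    (h : ∀ g, (φ g).charpolyRev = (ψ g).charpolyRev) (x : MonoidAlgebra R G) :
    (MonoidAlgebra.lift R _ G φ x).charpolyRev = (MonoidAlgebra.lift R _ G ψ x).charpolyRev := by
  have key : ∀ N : ℕ, (X : R[X]) ^ N ∣ (MonoidAlgebra.lift R _ G φ x).charpolyRev -
      (MonoidAlgebra.lift R _ G ψ x).charpolyRev := by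
    intro N
    rw [← Ideal.mem_span_singleton, ← Ideal.Quotient.eq_zero_iff_mem, map_sub, sub_eq_zero]
    set q := Ideal.Quotient.mk (Ideal.span {(X : R[X]) ^ N}) with hq
    have ht : (q X) ^ N = 0 := by
      rw [← map_pow, Ideal.Quotient.eq_zero_iff_mem]
      exact Ideal.mem_span_singleton_self _
    obtain ⟨D, hD1, hD2⟩ := bn_aux q φ
    obtain ⟨D', hD1', hD2'⟩ := bn_aux q ψ
    rw [← hD2, ← hD2']
    refine bn_key1 _ N ht D D' ?_ _
    intro g c
    rw [hD1, hD1', h]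
  by_contra hne
  have := Polynomial.natDegree_le_of_dvd
    (key (((MonoidAlgebra.lift R _ G φ x).charpolyRev -
      (MonoidAlgebra.lift R _ G ψ x).charpolyRev).natDegree + 1)) (sub_ne_zero.mpr hne)
  rw [Polynomial.natDegree_X_pow] at this
  omega


theorem bn_lift {R G V n : Type*} [Field R] [Monoid G] [AddCommGroup V] [Module R V]
    [Module (MonoidAlgebra R G) V] [IsScalarTower R (MonoidAlgebra R G) V]
    [Fintype n] [DecidableEq n] (b : Module.Basis n R V) :
    ∃ φ : G →* Matrix n n R, ∀ x, MonoidAlgebra.lift R _ G φ x =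
      LinearMap.toMatrix b b (Algebra.lsmul R R V x) := by
  let F : MonoidAlgebra R G →ₐ[R] Matrix n n R :=
    (LinearMap.toMatrixAlgEquiv b).toAlgHom.comp (Algebra.lsmul R R V)
  refine ⟨(MonoidAlgebra.lift R _ G).symm F, fun x => ?_⟩
  rw [Equiv.apply_symm_apply]
  rfl

theorem bn_mod {R G V W : Type*} [Field R] [Monoid G]
    [AddCommGroup V] [Module R V] [FiniteDimensional R V]
    [Module (MonoidAlgebra R G) V] [IsScalarTower R (MonoidAlgebra R G) V]
    [AddCommGroup W] [Module R W] [FiniteDimensional R W]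
    [Module (MonoidAlgebra R G) W] [IsScalarTower R (MonoidAlgebra R G) W]
    (h : ∀ g : G, (Algebra.lsmul R R V (MonoidAlgebra.of R G g)).charpoly =
      (Algebra.lsmul R R W (MonoidAlgebra.of R G g)).charpoly)
    (x : MonoidAlgebra R G) (hx : ∀ w : W, x • w = 0) (v : V) (hv : x • v = v) : v = 0 := by
  classical
  let b := Module.finBasis R V
  let c := Module.finBasis R W
  obtain ⟨φ, hφ⟩ := bn_lift (G := G) b
  obtain ⟨ψ, hψ⟩ := bn_lift (G := G) c
  have key := bn_key2 φ ψ (fun g => by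
    have h1 := hφ (MonoidAlgebra.of R G g)
    have h2 := hψ (MonoidAlgebra.of R G g)
    rw [MonoidAlgebra.lift_of] at h1 h2
    rw [h1, h2, ← Matrix.reverse_charpoly, ← Matrix.reverse_charpoly,
      LinearMap.charpoly_toMatrix, LinearMap.charpoly_toMatrix, h]) x
  rw [hφ, hψ] at key
  have h0 : Algebra.lsmul R R W x = 0 := by
    ext w; exact hx w
  rw [h0] at key
  have key2 := congrArg (Polynomial.evalRingHom (1 : R)) key
  rw [Matrix.charpolyRev, Matrix.charpolyRev, RingHom.map_det, RingHom.map_det] at key2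
  have e1 : (Polynomial.evalRingHom (1 : R)).mapMatrix
      (1 - (X : R[X]) • (LinearMap.toMatrix b b (Algebra.lsmul R R V x)).map C) =
      LinearMap.toMatrix b b (1 - Algebra.lsmul R R V x) := by
    rw [map_sub (LinearMap.toMatrix b b), LinearMap.toMatrix_one]
    ext i j
    simp [Matrix.one_apply, apply_ite]
  rw [e1, LinearMap.det_toMatrix] at key2
  have e2 : LinearMap.det (1 - Algebra.lsmul R R V x) = 1 := by
    rw [key2]; simp
  have e3 : IsUnit (1 - Algebra.lsmul R R V x) := by
    rw [LinearMap.isUnit_iff_isUnit_det, e2]; exact isUnit_one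
  have e4 := (Module.End.isUnit_iff _).mp e3
  apply e4.1
  simp [hv]

theorem bn_density {R G S W : Type*} [Field R] [Monoid G]
    [AddCommGroup S] [Module R S] [FiniteDimensional R S]
    [Module (MonoidAlgebra R G) S] [IsScalarTower R (MonoidAlgebra R G) S]
    [AddCommGroup W] [Module R W] [FiniteDimensional R W]
    [Module (MonoidAlgebra R G) W] [IsScalarTower R (MonoidAlgebra R G) W]
    [IsSemisimpleModule (MonoidAlgebra R G) S] [IsSemisimpleModule (MonoidAlgebra R G) W]
    (h1 : ∀ f : S →ₗ[MonoidAlgebra R G] W, f = 0)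
    (h2 : ∀ f : W →ₗ[MonoidAlgebra R G] S, f = 0) :
    ∃ x : MonoidAlgebra R G, (∀ s : S, x • s = s) ∧ ∀ w : W, x • w = 0 := by
  classical
  let f : Module.End (Module.End (MonoidAlgebra R G) (S × W)) (S × W) :=
    { toFun := fun p => (p.1, 0)
      map_add' := by intro a b; simp
      map_smul' := by
        intro T p
        have a1 : ∀ s : S, (T (s, 0)).2 = 0 := fun s =>
          LinearMap.congr_fun (h1 (LinearMap.snd _ _ _ ∘ₗ T ∘ₗ LinearMap.inl _ _ _)) s
        have a2 : ∀ w : W, (T (0, w)).1 = 0 := fun w =>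
          LinearMap.congr_fun (h2 (LinearMap.fst _ _ _ ∘ₗ T ∘ₗ LinearMap.inr _ _ _)) w
        have a3 : T p = T (p.1, 0) + T (0, p.2) := by rw [← map_add]; simp
        simp only [Module.End.smul_def, RingHom.id_apply]
        rw [a3]
        ext
        · simp [a2]
        · simp [a1] }
  let b := Module.finBasis R (S × W)
  have hss : IsSemisimpleModule (MonoidAlgebra R G) (S × W) := by
    have i1 : IsSemisimpleModule (MonoidAlgebra R G)
        (LinearMap.range (LinearMap.inl (MonoidAlgebra R G) S W)) := IsSemisimpleModule.range _
    have i2 : IsSemisimpleModule (MonoidAlgebra R G)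
        (LinearMap.range (LinearMap.inr (MonoidAlgebra R G) S W)) := IsSemisimpleModule.range _
    have i3 := IsSemisimpleModule.sup i1 i2
    rw [LinearMap.sup_range_inl_inr] at i3
    exact IsSemisimpleModule.congr Submodule.topEquiv.symm
  obtain ⟨x, hx⟩ := jacobson_density f (Finset.univ.image b)
  have hb : ∀ p : S × W, x • p = (p.1, 0) := by
    intro p
    have : Algebra.lsmul R R (S × W) x = LinearMap.inl R S W ∘ₗ LinearMap.fst R S W := by
      refine b.ext fun i => ?_
      exact (hx (b i) (by simp)).symm
    exact LinearMap.congr_fun this p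
  refine ⟨x, fun s => ?_, fun w => ?_⟩
  · exact congrArg Prod.fst (hb (s, 0))
  · exact congrArg Prod.snd (hb (0, w))

theorem bn_charpoly_prod {R G V S T : Type*} [Field R] [Monoid G]
    [AddCommGroup V] [Module R V] [FiniteDimensional R V]
    [Module (MonoidAlgebra R G) V] [IsScalarTower R (MonoidAlgebra R G) V]
    [AddCommGroup S] [Module R S] [FiniteDimensional R S]
    [Module (MonoidAlgebra R G) S] [IsScalarTower R (MonoidAlgebra R G) S]
    [AddCommGroup T] [Module R T] [FiniteDimensional R T]
    [Module (MonoidAlgebra R G) T] [IsScalarTower R (MonoidAlgebra R G) T]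
    (e : (S × T) ≃ₗ[MonoidAlgebra R G] V) (x : MonoidAlgebra R G) :
    (Algebra.lsmul R R V x).charpoly =
      (Algebra.lsmul R R S x).charpoly * (Algebra.lsmul R R T x).charpoly := by
  rw [← LinearMap.charpoly_prodMap, ← LinearEquiv.charpoly_conj (e.restrictScalars R)]
  congr 1
  ext v
  rw [LinearEquiv.conj_apply_apply]
  have : v = e (e.symm v) := by simp
  conv_lhs => rw [this]
  change x • e (e.symm v) = e (x • (e.symm v))
  rw [map_smul]

theorem bn_main {R G : Type*} [Field R] [Monoid G] (n : ℕ) :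
    ∀ {V : Type u} {W : Type v}
    [AddCommGroup V] [Module R V] [FiniteDimensional R V]
    [Module (MonoidAlgebra R G) V] [IsScalarTower R (MonoidAlgebra R G) V]
    [AddCommGroup W] [Module R W] [FiniteDimensional R W]
    [Module (MonoidAlgebra R G) W] [IsScalarTower R (MonoidAlgebra R G) W]
    [IsSemisimpleModule (MonoidAlgebra R G) V] [IsSemisimpleModule (MonoidAlgebra R G) W]
    (_ : ∀ g : G, (Algebra.lsmul R R V (MonoidAlgebra.of R G g)).charpoly =
      (Algebra.lsmul R R W (MonoidAlgebra.of R G g)).charpoly)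
    (_ : Module.finrank R V = n),
    Nonempty (V ≃ₗ[MonoidAlgebra R G] W) := by
  induction n using Nat.strong_induction_on with
  | _ n ih =>
  intro V W _ _ _ _ _ _ _ _ _ _ _ _ h hn
  have hdim : Module.finrank R V = Module.finrank R W := by
    have := congrArg Polynomial.natDegree (h 1)
    rwa [LinearMap.charpoly_natDegree, LinearMap.charpoly_natDegree] at this
  rcases subsingleton_or_nontrivial V with hV | hV
  · have : Subsingleton W := by
      rw [← Module.finrank_zero_iff (R := R), ← hdim, Module.finrank_zero_iff]
      exact hV
    exact ⟨0⟩
  obtain ⟨S, hS⟩ := IsSemisimpleModule.exists_simple_submodule (MonoidAlgebra R G) V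
  have hSn : Nontrivial S := IsSimpleModule.nontrivial (MonoidAlgebra R G) S
  have hex : ∃ T : Submodule (MonoidAlgebra R G) W, Nonempty (S ≃ₗ[MonoidAlgebra R G] T) := by
    by_contra hcon
    have h2 : ∀ f : W →ₗ[MonoidAlgebra R G] S, f = 0 := fun f => by
      by_contra hf
      exact hcon (LinearMap.linearEquiv_of_ne_zero hf)
    have h1 : ∀ f : S →ₗ[MonoidAlgebra R G] W, f = 0 := fun f => by
      by_contra hf
      exact hcon ⟨_, ⟨LinearEquiv.ofInjective f (LinearMap.injective_of_ne_zero hf)⟩⟩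
    have : FiniteDimensional R S :=
      inferInstanceAs (FiniteDimensional R (S.restrictScalars R))
    obtain ⟨x, hx1, hx2⟩ := bn_density h1 h2
    obtain ⟨s, hs⟩ := exists_ne (0 : S)
    apply hs
    apply Subtype.ext
    exact bn_mod h x hx2 (s : V) (congrArg Subtype.val (hx1 s))
  obtain ⟨T, ⟨e⟩⟩ := hex
  obtain ⟨S', hS'⟩ := exists_isCompl S
  obtain ⟨T', hT'⟩ := exists_isCompl T
  have : FiniteDimensional R S := inferInstanceAs (FiniteDimensional R (S.restrictScalars R))
  have : FiniteDimensional R S' := inferInstanceAs (FiniteDimensional R (S'.restrictScalars R))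
  have : FiniteDimensional R T := inferInstanceAs (FiniteDimensional R (T.restrictScalars R))
  have : FiniteDimensional R T' := inferInstanceAs (FiniteDimensional R (T'.restrictScalars R))
  let eV := Submodule.prodEquivOfIsCompl S S' hS'
  let eW := (e.prodCongr (LinearEquiv.refl _ T')).trans (Submodule.prodEquivOfIsCompl T T' hT')
  have h' : ∀ g : G, (Algebra.lsmul R R S' (MonoidAlgebra.of R G g)).charpoly =
      (Algebra.lsmul R R T' (MonoidAlgebra.of R G g)).charpoly := by
    intro g
    have := h g
    rw [bn_charpoly_prod eV, bn_charpoly_prod eW] at this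
    exact mul_left_cancel₀ (LinearMap.charpoly_monic _).ne_zero this
  have hlt : Module.finrank R S' < n := by
    have h3 := (eV.restrictScalars R).finrank_eq
    rw [Module.finrank_prod] at h3
    have : 0 < Module.finrank R S := Module.finrank_pos
    omega
  obtain ⟨e'⟩ := ih _ hlt h' rfl
  exact ⟨eV.symm.trans (((LinearEquiv.refl _ S).prodCongr e').trans eW)⟩

end BN


/-- **Brauer–Nesbitt.** Two semisimple finite-dimensional representations of a group `G`
over a field `R` whose characteristic polynomials agree at every group element
are isomorphic. -/
theorem brauer_nesbitt
    {R : Type*} [Field R] {G : Type*} [Group G]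
    {V W : Type*} [AddCommGroup V] [Module R V] [FiniteDimensional R V]
    [AddCommGroup W] [Module R W] [FiniteDimensional R W]
    (ρ : Representation R G V) (ρ' : Representation R G W)
    (hV : IsSemisimpleModule (MonoidAlgebra R G) ρ.asModule)
    (hW : IsSemisimpleModule (MonoidAlgebra R G) ρ'.asModule)
    (h : ∀ g : G, (ρ g).charpoly = (ρ' g).charpoly) :
    ∃ e : V ≃ₗ[R] W, ∀ (g : G) (v : V), e (ρ g v) = ρ' g (e v) := by
  have key := bn_main (R := R) (G := G) (Module.finrank R ρ.asModule)
    (V := ρ.asModule) (W := ρ'.asModule) ?_ rfl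
  · obtain ⟨e⟩ := key
    refine ⟨ρ.asModuleEquiv.symm.trans ((e.restrictScalars R).trans ρ'.asModuleEquiv), ?_⟩
    intro g v
    simp only [LinearEquiv.trans_apply, LinearEquiv.restrictScalars_apply]
    rw [Representation.asModuleEquiv_symm_map_rho, map_smul,
      Representation.asModuleEquiv_map_smul, Representation.asAlgebraHom_of]
  · intro g
    have h1 : ∀ {U : Type _} [AddCommGroup U] [Module R U] [FiniteDimensional R U]
        (σ : Representation R G U), Algebra.lsmul R R σ.asModule (MonoidAlgebra.of R G g) =
          σ.asModuleEquiv.symm.conj (σ g) := by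
      intro U _ _ _ σ
      ext v
      rw [LinearEquiv.conj_apply_apply, Representation.asModuleEquiv_symm_map_rho]
      simp
      rfl
    have h2 : ∀ {U : Type _} [AddCommGroup U] [Module R U] [FiniteDimensional R U]
        (σ : Representation R G U), Algebra.lsmul R R σ.asModule (MonoidAlgebra.of R G g) =
          σ.asModuleEquiv.symm.conj (σ g) := by
      intro U _ _ _ σ
      ext v
      rw [LinearEquiv.conj_apply_apply, Representation.asModuleEquiv_symm_map_rho]
      simp
      rfl
    rw [h1 ρ, h2 ρ', LinearEquiv.charpoly_conj, LinearEquiv.charpoly_conj, h]
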